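/- There exists a constant C_d > 0 such that for each x ∈ ℝ^d there exists a family (g_{1,x}, g_{2,x}, …, g_{d,x}) ∈ 𝒪(ℤ^d)^d with g_{1,x} = Id_{ℝ^d}, such that the linear map L_x : ℝ^d → ℝ^d defined by L_x(e_i) = g_{i,x}(x) for i = 1,…,d satisfies C_d‖y‖₁‖x‖₁ ≤ ‖L_x(y)‖₁ ≤ ‖y‖₁‖x‖₁ for all y ∈ ℝ^d. Moreover, for each Euclidean unit vector n ∈ 𝒮₂, setting (n₁,…,n_d) = (n, g_{2,n}(n), …, g_{d,n}(n)), one has (C_d/d^{3/2})‖y‖₂ ≤ ( Σ_{m=1}^d ⟨y, n_m⟩² )^{1/2} ≤ √d · ‖y‖₂ for all y ∈ ℝ^d. -/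

import Mathlib

open Filter

namespace ChemDist

/-- The `ℓ¹` norm on `ℝ^d`. -/
noncomputable def nrm1 {d : ℕ} (x : Fin d → ℝ) : ℝ := ∑ i, |x i|

/-- The Euclidean norm on `ℝ^d`. -/
noncomputable def nrm2 {d : ℕ} (x : Fin d → ℝ) : ℝ := Real.sqrt (∑ i, (x i) ^ 2)

/-- The Euclidean inner product on `ℝ^d`. -/
noncomputable def inn {d : ℕ} (x y : Fin d → ℝ) : ℝ := ∑ i, x i * y i

/-- `g` belongs to `𝒪(ℤ^d)`: it is a map `Ψ_{σ,ε}(x) = ∑ᵢ ε(i) x_{σ(i)} eᵢ` for a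
permutation `σ` of the coordinates and signs `ε ∈ {±1}^d`. -/
def IsLatticeIso {d : ℕ} (g : (Fin d → ℝ) → (Fin d → ℝ)) : Prop :=
  ∃ (σ : Equiv.Perm (Fin d)) (ε : Fin d → ℝ),
    (∀ i, ε i = 1 ∨ ε i = -1) ∧ ∀ (x : Fin d → ℝ) (i : Fin d), g x i = ε i * x (σ i)

/-- If the row `R i` is the average of the rows `P i` and `Q i` for every `i`, then one can choose
one of the two in each row without decreasing the absolute value of the determinant. -/
theorem exists_abs_det_le_of_row_average {n : Type*} [Fintype n] [DecidableEq n]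
    (R P Q : Matrix n n ℝ) (h : ∀ i, P i + Q i = (2 : ℝ) • R i) :
    ∃ A : Matrix n n ℝ, (∀ i, A i = P i ∨ A i = Q i) ∧ |R.det| ≤ |A.det| := by
  suffices H : ∀ s : Finset n, ∃ A : Matrix n n ℝ, (∀ i ∈ s, A i = P i ∨ A i = Q i) ∧
      (∀ i ∉ s, A i = R i) ∧ |R.det| ≤ |A.det| by
    obtain ⟨A, hA, -, hdet⟩ := H Finset.univ
    exact ⟨A, fun i => hA i (Finset.mem_univ i), hdet⟩
  intro s
  induction s using Finset.induction_on with
  | empty => exact ⟨R, by simp, by simp, le_rfl⟩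
  | insert a s ha ih =>
    obtain ⟨A, hA, hAR, hdet⟩ := ih
    have hsum : (A.updateRow a (P a)).det + (A.updateRow a (Q a)).det = 2 * A.det := by
      rw [← Matrix.det_updateRow_add, h a, Matrix.det_updateRow_smul, ← hAR a ha,
        Matrix.updateRow_eq_self]
    have hrow : ∀ r, (r = P a ∨ r = Q a) →
        (∀ i ∈ insert a s, A.updateRow a r i = P i ∨ A.updateRow a r i = Q i) ∧
        ∀ i ∉ insert a s, A.updateRow a r i = R i := by
      intro r hr
      refine ⟨fun i hi => ?_, fun i hi => ?_⟩
      · by_cases hia : i = a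
        · subst hia
          simpa using hr
        · rw [Matrix.updateRow_ne hia]
          exact hA i ((Finset.mem_insert.1 hi).resolve_left hia)
      · rw [Finset.mem_insert, not_or] at hi
        rw [Matrix.updateRow_ne hi.1]
        exact hAR i hi.2
    have habs : 2 * |A.det| ≤ |(A.updateRow a (P a)).det| + |(A.updateRow a (Q a)).det| := by
      have := abs_add_le (A.updateRow a (P a)).det (A.updateRow a (Q a)).det
      rwa [hsum, abs_mul, abs_two] at this
    rcases le_total |A.det| |(A.updateRow a (P a)).det| with hP | hP
    · exact ⟨_, (hrow _ (.inl rfl)).1, (hrow _ (.inl rfl)).2, hdet.trans hP⟩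
    · exact ⟨_, (hrow _ (.inr rfl)).1, (hrow _ (.inr rfl)).2, by linarith⟩

/-- The lattice isometry `x ↦ (1, s, …, s) · x ∘ swap p k`, the sign `1` being in position `p`. -/
def swapSign {d : ℕ} (p k : Fin d) (s : ℝ) (x : Fin d → ℝ) : Fin d → ℝ :=
  fun j => (if j = p then 1 else s) * x (Equiv.swap p k j)

theorem isLatticeIso_swapSign {d : ℕ} (p k : Fin d) {s : ℝ} (hs : s = 1 ∨ s = -1) :
    IsLatticeIso (swapSign p k s) := by
  refine ⟨Equiv.swap p k, fun j => if j = p then 1 else s, fun i => ?_, fun x i => rfl⟩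
  dsimp only
  split_ifs
  · exact .inl rfl
  · exact hs

theorem swapSign_self_one {d : ℕ} (k : Fin d) : swapSign k k 1 = id := by
  funext x j
  simp [swapSign]

theorem swapSign_add_swapSign_neg {d : ℕ} (p k : Fin d) (x : Fin d → ℝ) :
    swapSign p k 1 x + swapSign p k (-1) x = (2 : ℝ) • Pi.single p (x k) := by
  funext j
  by_cases hj : j = p
  · subst hj
    simp [swapSign, two_mul]
  · simp [swapSign, hj]

theorem abs_det_update_single {d : ℕ} (z k : Fin d) (hz : ∀ i, z ≤ i) (x : Fin d → ℝ) :
    |(Matrix.of fun i => if i = z then x else Pi.single (Equiv.swap z k i) (x k)).det|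
      = |x k| ^ d := by
  set R : Matrix (Fin d) (Fin d) ℝ :=
    Matrix.of fun i => if i = z then x else Pi.single (Equiv.swap z k i) (x k) with hR
  have hsub : |(R.submatrix id (Equiv.swap z k)).det| = |R.det| := by
    rw [Matrix.det_permute', abs_mul]
    rcases Int.units_eq_one_or (Equiv.Perm.sign (Equiv.swap z k)) with h | h <;> simp [h]
  have htri : (R.submatrix id (Equiv.swap z k)).BlockTriangular id := by
    intro i j hij
    have hiz : i ≠ z := ((hz j).trans_lt hij).ne'
    have hne : j ≠ i := ne_of_lt hij
    simp [hR, hiz, hne]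
  have hdiag : ∀ i, (R.submatrix id (Equiv.swap z k)) i i = x k := by
    intro i
    by_cases hi : i = z
    · subst hi
      simp [hR]
    · simp [hR, hi]
  rw [← hsub, Matrix.det_of_isUpperTriangular htri, Finset.prod_congr rfl fun i _ => hdiag i]
  simp [abs_pow]

/-- The images of `x` under suitable lattice isometries span a large volume. -/
theorem exists_isLatticeIso_le_abs_det {d : ℕ} (z k : Fin d) (hz : ∀ i, z ≤ i) (x : Fin d → ℝ) :
    ∃ g : Fin d → (Fin d → ℝ) → (Fin d → ℝ), g z = id ∧ (∀ i, IsLatticeIso (g i)) ∧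
      |x k| ^ d ≤ |(Matrix.of fun i => g i x).det| := by
  obtain ⟨A, hA, hdet⟩ := exists_abs_det_le_of_row_average
    (Matrix.of fun i => if i = z then x else Pi.single (Equiv.swap z k i) (x k))
    (Matrix.of fun i => swapSign (Equiv.swap z k i) k 1 x)
    (Matrix.of fun i => swapSign (Equiv.swap z k i) k (if i = z then 1 else -1) x) (by
      intro i
      by_cases hi : i = z
      · subst hi
        funext j
        simp [swapSign_self_one, two_mul]
      · change swapSign (Equiv.swap z k i) k 1 x +
          swapSign (Equiv.swap z k i) k (if i = z then 1 else -1) x =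
            (2 : ℝ) • (if i = z then x else Pi.single (Equiv.swap z k i) (x k))
        rw [if_neg hi, if_neg hi]
        exact swapSign_add_swapSign_neg (Equiv.swap z k i) k x)
  change ∀ i, A i = swapSign (Equiv.swap z k i) k 1 x ∨
    A i = swapSign (Equiv.swap z k i) k (if i = z then 1 else -1) x at hA
  rw [abs_det_update_single z k hz] at hdet
  have hg : ∀ i, ∃ f : (Fin d → ℝ) → (Fin d → ℝ), (i = z → f = id) ∧ IsLatticeIso f ∧
      f x = A i := by
    intro i
    by_cases hi : i = z
    · subst hi
      refine ⟨swapSign k k 1, fun _ => swapSign_self_one k, isLatticeIso_swapSign _ _ (.inl rfl), ?_⟩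
      rcases hA i with h | h <;> simp [h]
    · rcases hA i with h | h
      · exact ⟨_, fun hz => absurd hz hi, isLatticeIso_swapSign (Equiv.swap z k i) k (.inl rfl),
          h.symm⟩
      · refine ⟨_, fun hz => absurd hz hi, isLatticeIso_swapSign (Equiv.swap z k i) k (.inr rfl), ?_⟩
        simp [h, hi]
  choose g hid hiso hgA using hg
  refine ⟨g, hid z rfl, hiso, ?_⟩
  have : (Matrix.of fun i => g i x) = A := by
    funext i
    exact hgA i
  rwa [this]

theorem nrm1_smul {d : ℕ} (c : ℝ) (x : Fin d → ℝ) : nrm1 (c • x) = |c| * nrm1 x := by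
  simp [nrm1, abs_mul, Finset.mul_sum]

theorem nrm1_nonneg {d : ℕ} (x : Fin d → ℝ) : 0 ≤ nrm1 x :=
  Finset.sum_nonneg fun _ _ => abs_nonneg _

theorem nrm1_le_of_one_le_abs_det {d : ℕ} (B : Matrix (Fin d) (Fin d) ℝ)
    (hB : ∀ i j, |B i j| ≤ 1) (hdet : 1 ≤ |B.det|) (y : Fin d → ℝ) :
    nrm1 y ≤ d * d.factorial * nrm1 (B.mulVec y) := by
  have hadj : ∀ i j, |B.adjugate i j| ≤ d.factorial := by
    intro i j
    rw [Matrix.adjugate_apply]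
    have := Matrix.det_le (A := B.updateRow j (Pi.single i 1))
      (abv := IsAbsoluteValue.toAbsoluteValue (abs : ℝ → ℝ)) (x := 1) (by
        intro a b
        change |_| ≤ _
        rw [Matrix.updateRow_apply]
        split_ifs
        · rw [Pi.single_apply]
          split_ifs <;> simp
        · exact hB a b)
    simpa using this
  have hy : B.adjugate.mulVec (B.mulVec y) = B.det • y := by
    rw [Matrix.mulVec_mulVec, Matrix.adjugate_mul, Matrix.smul_mulVec, Matrix.one_mulVec]
  have hcoord : ∀ i, |y i| ≤ d.factorial * nrm1 (B.mulVec y) := by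
    intro i
    calc |y i| ≤ |B.det| * |y i| := le_mul_of_one_le_left (abs_nonneg _) hdet
      _ = |∑ j, B.adjugate i j * B.mulVec y j| := by
        rw [← abs_mul]
        exact congrArg abs (congrFun hy i).symm
      _ ≤ ∑ j, |B.adjugate i j * B.mulVec y j| := Finset.abs_sum_le_sum_abs _ _
      _ ≤ ∑ j, d.factorial * |B.mulVec y j| := by
        refine Finset.sum_le_sum fun j _ => ?_
        rw [abs_mul]
        exact mul_le_mul_of_nonneg_right (hadj i j) (abs_nonneg _)
      _ = d.factorial * nrm1 (B.mulVec y) := by rw [nrm1, Finset.mul_sum]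
  calc nrm1 y ≤ ∑ _i : Fin d, d.factorial * nrm1 (B.mulVec y) :=
        Finset.sum_le_sum fun i _ => hcoord i
    _ = d * d.factorial * nrm1 (B.mulVec y) := by simp [mul_assoc]

theorem mul_nrm1_le_of_pow_le_abs_det {d : ℕ} (A : Matrix (Fin d) (Fin d) ℝ) {M : ℝ}
    (hM : 0 ≤ M) (hA : ∀ i j, |A i j| ≤ M) (hdet : M ^ d ≤ |A.det|) (y : Fin d → ℝ) :
    M * nrm1 y ≤ d * d.factorial * nrm1 (A.mulVec y) := by
  rcases hM.eq_or_lt with rfl | hM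
  · rw [zero_mul]
    exact mul_nonneg (by positivity) (nrm1_nonneg _)
  have h := nrm1_le_of_one_le_abs_det (M⁻¹ • A) (fun i j => ?_) ?_ y
  · rw [Matrix.smul_mulVec, nrm1_smul, abs_of_pos (inv_pos.2 hM)] at h
    calc M * nrm1 y ≤ M * (d * d.factorial * (M⁻¹ * nrm1 (A.mulVec y))) :=
          mul_le_mul_of_nonneg_left h hM.le
      _ = d * d.factorial * nrm1 (A.mulVec y) := by field_simp
  · rw [Matrix.smul_apply, smul_eq_mul, abs_mul, abs_of_pos (inv_pos.2 hM), inv_mul_le_iff₀ hM,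
      mul_one]
    exact hA i j
  · rw [Matrix.det_smul, Fintype.card_fin, abs_mul, inv_pow, abs_of_pos (by positivity),
      le_inv_mul_iff₀ (by positivity), mul_one]
    exact hdet

theorem nrm2_le_nrm1 {d : ℕ} (x : Fin d → ℝ) : nrm2 x ≤ nrm1 x := by
  rw [nrm2, Real.sqrt_le_left (nrm1_nonneg x), nrm1]
  simpa using Finset.sum_sq_le_sq_sum_of_nonneg (s := Finset.univ) (f := fun i => |x i|)
    (fun i _ => abs_nonneg _)

theorem nrm1_le_sqrt_mul_nrm2 {d : ℕ} (x : Fin d → ℝ) : nrm1 x ≤ Real.sqrt d * nrm2 x := by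
  rw [nrm2, ← Real.sqrt_mul (Nat.cast_nonneg d)]
  apply Real.le_sqrt_of_sq_le
  simpa [nrm1] using sq_sum_le_card_mul_sum_sq (s := Finset.univ) (f := fun i => |x i|)

theorem IsLatticeIso.nrm1_eq {d : ℕ} {g : (Fin d → ℝ) → (Fin d → ℝ)} (hg : IsLatticeIso g)
    (x : Fin d → ℝ) : nrm1 (g x) = nrm1 x := by
  obtain ⟨σ, ε, hε, hg⟩ := hg
  have : ∀ i, |g x i| = |x (σ i)| := fun i => by rcases hε i with h | h <;> simp [hg, h]
  simp only [nrm1, this]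
  exact Equiv.sum_comp σ fun i => |x i|

theorem IsLatticeIso.sum_sq_eq {d : ℕ} {g : (Fin d → ℝ) → (Fin d → ℝ)} (hg : IsLatticeIso g)
    (x : Fin d → ℝ) : ∑ i, g x i ^ 2 = ∑ i, x i ^ 2 := by
  obtain ⟨σ, ε, hε, hg⟩ := hg
  have : ∀ i, g x i ^ 2 = x (σ i) ^ 2 := fun i => by rcases hε i with h | h <;> simp [hg, h]
  simp only [this]
  exact Equiv.sum_comp σ fun i => x i ^ 2

theorem IsLatticeIso.abs_apply_le {d : ℕ} {g : (Fin d → ℝ) → (Fin d → ℝ)} (hg : IsLatticeIso g)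
    {x : Fin d → ℝ} {M : ℝ} (hx : ∀ i, |x i| ≤ M) (i : Fin d) : |g x i| ≤ M := by
  obtain ⟨σ, ε, hε, hg⟩ := hg
  rcases hε i with h | h <;> simpa [hg, h] using hx (σ i)

theorem nrm1_sum_mul_le {d : ℕ} (y : Fin d → ℝ) (v : Fin d → Fin d → ℝ) {c : ℝ}
    (hv : ∀ i, nrm1 (v i) = c) : nrm1 (fun j => ∑ i, y i * v i j) ≤ nrm1 y * c := by
  calc nrm1 (fun j => ∑ i, y i * v i j) ≤ ∑ j, ∑ i, |y i| * |v i j| := by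
        refine Finset.sum_le_sum fun j _ => (Finset.abs_sum_le_sum_abs _ _).trans_eq ?_
        simp only [abs_mul]
    _ = ∑ i, |y i| * nrm1 (v i) := by
        rw [Finset.sum_comm]
        simp only [nrm1, Finset.mul_sum]
    _ = nrm1 y * c := by simp only [hv, nrm1.eq_1 y, Finset.sum_mul]

theorem sqrt_sum_inn_sq_le {d : ℕ} (y : Fin d → ℝ) (v : Fin d → Fin d → ℝ)
    (hv : ∀ m, ∑ i, v m i ^ 2 = 1) :
    Real.sqrt (∑ m, inn y (v m) ^ 2) ≤ Real.sqrt d * nrm2 y := by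
  rw [nrm2, ← Real.sqrt_mul (Nat.cast_nonneg d)]
  apply Real.sqrt_le_sqrt
  calc ∑ m, inn y (v m) ^ 2 ≤ ∑ _m : Fin d, ∑ i, y i ^ 2 := by
        refine Finset.sum_le_sum fun m _ => ?_
        simpa [hv m, inn] using Finset.sum_mul_sq_le_sq_mul_sq Finset.univ y (v m)
    _ = d * ∑ i, y i ^ 2 := by simp

/-- **Adapted bases (Lemma 2.1 of Garet–Marchand).**  There is a constant `C_d > 0` such
that for each `x ∈ ℝ^d` there are `g₁ = Id, g₂, …, g_d ∈ 𝒪(ℤ^d)` such that the linear map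
`L_x` with `L_x(eᵢ) = gᵢ(x)` satisfies `C_d ‖y‖₁‖x‖₁ ≤ ‖L_x(y)‖₁ ≤ ‖y‖₁‖x‖₁` for all `y`;
moreover if `‖x‖₂ = 1`, setting `n_m = g_m(x)`, one has
`(C_d/d^{3/2}) ‖y‖₂ ≤ (∑_m ⟨y,n_m⟩²)^{1/2} ≤ √d ‖y‖₂` for all `y`. -/
theorem adapted_basis (d : ℕ) (hd : 1 ≤ d) :
    ∃ C : ℝ, 0 < C ∧
      ∀ x : Fin d → ℝ, ∃ g : Fin d → (Fin d → ℝ) → (Fin d → ℝ),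
        g ⟨0, by omega⟩ = id ∧ (∀ i, IsLatticeIso (g i)) ∧
        (∀ y : Fin d → ℝ,
          C * nrm1 y * nrm1 x ≤ nrm1 (fun j => ∑ i, y i * g i x j) ∧
          nrm1 (fun j => ∑ i, y i * g i x j) ≤ nrm1 y * nrm1 x) ∧
        (nrm2 x = 1 →
          ∀ y : Fin d → ℝ,
            C / (d : ℝ) ^ ((3 : ℝ) / 2) * nrm2 y ≤ Real.sqrt (∑ m, inn y (g m x) ^ 2) ∧
            Real.sqrt (∑ m, inn y (g m x) ^ 2) ≤ Real.sqrt d * nrm2 y) := by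
  have hd0 : (0 : ℝ) < d := by exact_mod_cast hd
  have hf : (0 : ℝ) < d.factorial := by exact_mod_cast d.factorial_pos
  refine ⟨((d : ℝ) ^ 2 * d.factorial)⁻¹, by positivity, fun x => ?_⟩
  have : Nonempty (Fin d) := ⟨⟨0, by omega⟩⟩
  obtain ⟨k, hk⟩ := Finite.exists_max fun i => |x i|
  obtain ⟨g, hg0, hg, hdet⟩ :=
    exists_isLatticeIso_le_abs_det ⟨0, by omega⟩ k (fun i => Nat.zero_le i.val) x
  set A : Matrix (Fin d) (Fin d) ℝ := Matrix.of fun i => g i x with hA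
  have hAle : ∀ i j, |A i j| ≤ |x k| := fun i j => (hg i).abs_apply_le hk j
  refine ⟨g, hg0, hg, fun y => ⟨?_, nrm1_sum_mul_le y _ fun i => (hg i).nrm1_eq x⟩,
    fun hx y => ⟨?_, sqrt_sum_inn_sq_le y _ fun m => ?_⟩⟩
  · have h := mul_nrm1_le_of_pow_le_abs_det A.transpose (abs_nonneg (x k))
      (fun i j => hAle j i) (by rwa [Matrix.det_transpose]) y
    have hL : A.transpose.mulVec y = fun j => ∑ i, y i * g i x j := by
      funext j
      simp [Matrix.mulVec, dotProduct, hA, mul_comm]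
    rw [hL] at h
    have hx1 : nrm1 x ≤ d * |x k| := by
      simpa [nrm1] using Finset.sum_le_sum fun i (_ : i ∈ Finset.univ) => hk i
    rw [mul_assoc, inv_mul_le_iff₀ (by positivity)]
    calc nrm1 y * nrm1 x ≤ nrm1 y * (d * |x k|) := mul_le_mul_of_nonneg_left hx1 (nrm1_nonneg y)
      _ = d * (|x k| * nrm1 y) := by ring
      _ ≤ d * (d * d.factorial * nrm1 fun j => ∑ i, y i * g i x j) :=
        mul_le_mul_of_nonneg_left h hd0.le
      _ = _ := by ring
  · have h := mul_nrm1_le_of_pow_le_abs_det A (abs_nonneg (x k)) hAle hdet y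
    have hL : nrm2 (A.mulVec y) = Real.sqrt (∑ m, inn y (g m x) ^ 2) := by
      simp [nrm2, Matrix.mulVec, dotProduct, hA, mul_comm, inn]
    rw [← hL]
    have hxk : 1 ≤ Real.sqrt d * |x k| := by
      rw [← hx, nrm2, ← Real.sqrt_sq (abs_nonneg (x k)), ← Real.sqrt_mul hd0.le]
      apply Real.sqrt_le_sqrt
      simpa using Finset.sum_le_sum fun i (_ : i ∈ Finset.univ) => sq_le_sq.2 (hk i)
    have hpow : 1 ≤ (d : ℝ) ^ ((3 : ℝ) / 2) :=
      Real.one_le_rpow (by exact_mod_cast hd) (by norm_num)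
    have hn : 0 ≤ nrm2 y := Real.sqrt_nonneg _
    calc ((d : ℝ) ^ 2 * d.factorial)⁻¹ / (d : ℝ) ^ ((3 : ℝ) / 2) * nrm2 y
        ≤ ((d : ℝ) ^ 2 * d.factorial)⁻¹ * nrm2 y :=
          mul_le_mul_of_nonneg_right (div_le_self (by positivity) hpow) hn
      _ ≤ nrm2 (A.mulVec y) := by
        rw [inv_mul_le_iff₀ (by positivity)]
        calc nrm2 y ≤ Real.sqrt d * |x k| * nrm2 y := le_mul_of_one_le_left hn hxk
          _ ≤ Real.sqrt d * |x k| * nrm1 y :=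
            mul_le_mul_of_nonneg_left (nrm2_le_nrm1 y) (by positivity)
          _ = Real.sqrt d * (|x k| * nrm1 y) := by ring
          _ ≤ Real.sqrt d * (d * d.factorial * (Real.sqrt d * nrm2 (A.mulVec y))) := by
            refine mul_le_mul_of_nonneg_left (h.trans ?_) (Real.sqrt_nonneg _)
            exact mul_le_mul_of_nonneg_left (nrm1_le_sqrt_mul_nrm2 _) (by positivity)
          _ = Real.sqrt d * Real.sqrt d * d * d.factorial * nrm2 (A.mulVec y) := by ring
          _ = (d : ℝ) ^ 2 * d.factorial * nrm2 (A.mulVec y) := by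
            rw [Real.mul_self_sqrt hd0.le]
            ring
  · rw [(hg m).sum_sq_eq]
    exact Real.sqrt_eq_one.1 hx

end ChemDist
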